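/- arXiv:0711.1956 — 5 statements merged into one kernel-verified Lean document; each statement's English description precedes it below -/
import Mathlib

section
/- Let n ≥ 1 and let P ∈ ℂ[x_1,…,x_n] be a homogeneous polynomial of degree 4. Define F = (F_1,…,F_n) : ℂ^n → ℂ^n by F_i = x_i + ∂P/∂x_i for i = 1,…,n. If the Jacobian determinant of F (the determinant of the matrix whose (i,j) entry is ∂F_i/∂x_j) is a nonzero constant polynomial, then each polynomial F_i is irreducible in ℂ[x_1,…,x_n]. -/
open MvPolynomial

lemma yag_scale {n d : ℕ} {S : Type*} [CommRing S] [Algebra ℂ S] {H : MvPolynomial (Fin n) ℂ}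
    (hH : H.IsHomogeneous d) (s : S) (g : Fin n → S) :
    aeval (fun j => s * g j) H = s ^ d * aeval g H := by
  rw [aeval_def, aeval_def, eval₂_eq', eval₂_eq', Finset.mul_sum]
  refine Finset.sum_congr rfl fun m hm => ?_
  have h1 : ∑ j, m j = d := by
    have := hH (mem_support_iff.mp hm)
    rw [← this]
    simp [Finsupp.weight_apply, Finsupp.sum_fintype]
  simp_rw [mul_pow]
  rw [Finset.prod_mul_distrib, Finset.prod_pow_eq_pow_sum, h1]
  ring

lemma yag_comm {n : ℕ} (i j : Fin n) (H : MvPolynomial (Fin n) ℂ) :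
    pderiv i (pderiv j H) = pderiv j (pderiv i H) := by
  ext m
  rw [coeff_pderiv, coeff_pderiv, coeff_pderiv, coeff_pderiv]
  by_cases h : i = j
  · subst h; rfl
  · simp only [Finsupp.add_apply, Finsupp.single_apply, h, Ne.symm h, if_false]
    rw [add_right_comm]
    push_cast
    ring

lemma yag_dvd {n : ℕ} (i : Fin n) (H : MvPolynomial (Fin n) ℂ)
    (h : ∀ a : Fin n → ℂ, a i = 0 → aeval a H = 0) : X i ∣ H := by
  let σ : MvPolynomial (Fin n) ℂ →ₐ[ℂ] MvPolynomial (Fin n) ℂ :=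
    aeval (fun j => if j = i then 0 else X j)
  have h0 : σ H = 0 := by
    apply MvPolynomial.funext
    intro a
    have h1 : ((aeval a).comp σ : MvPolynomial (Fin n) ℂ →ₐ[ℂ] ℂ)
        = aeval (fun j => if j = i then 0 else a j) := by
      ext j
      by_cases hj : j = i <;> simp [σ, hj]
    have h2 := DFunLike.congr_fun h1 H
    rw [h _ (by simp)] at h2
    simpa [aeval_eq_eval] using h2
  have h3 : (Ideal.Quotient.mkₐ ℂ (Ideal.span {(X i : MvPolynomial (Fin n) ℂ)})).comp σ
      = Ideal.Quotient.mkₐ ℂ (Ideal.span {(X i : MvPolynomial (Fin n) ℂ)}) := by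
    ext j
    by_cases hj : j = i
    · subst hj
      have : Ideal.Quotient.mk (Ideal.span {(X j : MvPolynomial (Fin n) ℂ)}) (X j) = 0 :=
        Ideal.Quotient.eq_zero_iff_mem.mpr (Ideal.mem_span_singleton_self _)
      simp [σ, this]
    · simp [σ, hj]
  have h4 := DFunLike.congr_fun h3 H
  simp only [AlgHom.comp_apply, h0, map_zero, Ideal.Quotient.mkₐ_eq_mk] at h4
  exact Ideal.mem_span_singleton.mp (Ideal.Quotient.eq_zero_iff_mem.mp h4.symm)

lemma yag_unit {n : ℕ} (i : Fin n) (H A B : MvPolynomial (Fin n) ℂ)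
    (hH : H.IsHomogeneous 3) (a : Fin n → ℂ) (ha : a i = 0) (hHa : aeval a H ≠ 0)
    (hAB : X i + H = A * B) (hA : aeval (0 : Fin n → ℂ) A ≠ 0) : IsUnit A := by
  let g : Fin n → Polynomial ℂ := fun j => Polynomial.X * Polynomial.C (a j)
  have h1 : aeval g H = Polynomial.X ^ 3 * Polynomial.C (aeval a H) := by
    rw [yag_scale hH]
    congr 1
    exact (MvPolynomial.aeval_algebraMap_apply (Polynomial ℂ) a H)
  have h2 : aeval g A * aeval g B = Polynomial.X ^ 3 * Polynomial.C (aeval a H) := by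
    rw [← map_mul, ← hAB, map_add, h1]
    simp [g, ha]
  have h3 : ¬ Polynomial.X ∣ aeval g A := by
    rw [Polynomial.X_dvd_iff, Polynomial.coeff_zero_eq_eval_zero]
    have : (Polynomial.aeval (0 : ℂ)).comp (aeval g) = (aeval (0 : Fin n → ℂ)) := by
      ext j; simp [g]
    have := DFunLike.congr_fun this A
    simp only [AlgHom.comp_apply, Polynomial.coe_aeval_eq_eval] at this
    rwa [this]
  have h4 : Polynomial.X ^ 3 ∣ aeval g B :=
    Polynomial.prime_X.pow_dvd_of_dvd_mul_left 3 h3 ⟨_, h2⟩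
  have hne : aeval g A * aeval g B ≠ 0 := by
    rw [h2]
    exact mul_ne_zero (pow_ne_zero _ Polynomial.X_ne_zero) (by simpa using hHa)
  have hB0 := right_ne_zero_of_mul hne
  have h5 : 3 ≤ (aeval g B).natDegree := by
    have := Polynomial.natDegree_le_of_dvd h4 hB0
    simpa using this
  have h6 : (aeval g B).natDegree ≤ B.totalDegree * 1 :=
    aeval_natDegree_le B le_rfl g fun j => by
      refine (Polynomial.natDegree_mul_C_le _ _).trans ?_
      simp
  have hA1 : A ≠ 0 := by rintro rfl; simp at hA
  have hB1 : B ≠ 0 := by rintro rfl; simp at hB0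
  have h7 := totalDegree_mul_of_isDomain hA1 hB1
  have h8 : (X i + H).totalDegree ≤ 3 := by
    refine (totalDegree_add _ _).trans (max_le ?_ hH.totalDegree_le)
    simp
  rw [hAB] at h8
  have h9 : A.totalDegree = 0 := by omega
  rw [totalDegree_eq_zero_iff_eq_C] at h9
  rw [h9]
  apply IsUnit.map
  rw [isUnit_iff_ne_zero]
  intro h
  rw [h] at h9
  simp at h9
  exact hA1 h9

lemma yag_harm {n : ℕ} (i : Fin n) (k : ℕ) (m : MvPolynomial (Fin n) ℂ)
    (h : ∑ j, pderiv j (pderiv j (X i ^ (k + 2) * m)) = 0) : X i ∣ m := by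
  have h1 : ∀ j ∈ Finset.univ, j ≠ i → X i ^ (k + 1) ∣ pderiv j (pderiv j (X i ^ (k + 2) * m)) := by
    intro j _ hj
    refine ⟨X i * pderiv j (pderiv j m), ?_⟩
    simp [pderiv_mul, pderiv_pow, pderiv_X_of_ne hj.symm]
    ring
  have h2 : X i ^ (k + 1) ∣ pderiv i (pderiv i (X i ^ (k + 2) * m)) := by
    rw [← Finset.add_sum_erase _ _ (Finset.mem_univ i)] at h
    rw [eq_neg_of_add_eq_zero_left h]
    apply (Dvd.dvd.neg_right)
    exact Finset.dvd_sum fun j hj => h1 j (Finset.mem_univ _) (Finset.ne_of_mem_erase hj)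
  have h3 : pderiv i (pderiv i (X i ^ (k + 2) * m)) = X i ^ k * (C (((k : ℂ) + 2) * ((k : ℂ) + 1)) * m)
      + X i ^ (k + 1) * (C (2 * ((k : ℂ) + 2)) * pderiv i m + X i * pderiv i (pderiv i m)) := by
    have hC2 : (C (2 : ℂ) : MvPolynomial (Fin n) ℂ) = 2 := map_ofNat C 2
    have hD2 : pderiv i (2 : MvPolynomial (Fin n) ℂ) = 0 := by rw [← hC2, pderiv_C]
    simp [hC2, hD2]
    ring
  rw [h3, dvd_add_left (dvd_mul_right _ _), pow_succ,
    mul_dvd_mul_iff_left (pow_ne_zero _ (X_ne_zero i))] at h2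
  rcases X_prime.dvd_or_dvd h2 with h4 | h4
  · exfalso
    have hne : ((k : ℂ) + 2) * (k + 1) ≠ 0 := by
      have : ((k : ℂ) + 2) ≠ 0 := by exact_mod_cast (Nat.succ_ne_zero (k + 1))
      have : ((k : ℂ) + 1) ≠ 0 := by exact_mod_cast (Nat.succ_ne_zero k)
      positivity
    have : IsUnit (X i : MvPolynomial (Fin n) ℂ) :=
      isUnit_of_dvd_unit h4 ((isUnit_iff_ne_zero.mpr hne).map C)
    exact X_prime.not_unit this
  · exact h4

/-- If `P` is homogeneous of degree 4 and `F i = x i + ∂P/∂x i` has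
constant nonzero Jacobian determinant, then each `F i` is irreducible. -/
theorem yagzhev_symmetric_coords_irreducible
    (n : ℕ) (hn : 1 ≤ n) (P : MvPolynomial (Fin n) ℂ)
    (hP : P.IsHomogeneous 4)
    (F : Fin n → MvPolynomial (Fin n) ℂ)
    (hF : ∀ i, F i = X i + pderiv i P)
    (c : ℂ) (hc : c ≠ 0)
    (hJac : (Matrix.of fun i j => pderiv j (F i)).det = C c) :
    ∀ i, Irreducible (F i) := by
  have hH : ∀ i, (pderiv i P).IsHomogeneous 3 := fun i => hP.pderiv
  have hHH : ∀ i j, (pderiv j (pderiv i P)).IsHomogeneous 2 := fun i j => (hH i).pderiv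
  -- evaluated Jacobian
  have hJ : ∀ a : Fin n → ℂ, (1 + Matrix.of fun i j => aeval a (pderiv j (pderiv i P))).det = c := by
    intro a
    have := congrArg (aeval a : MvPolynomial (Fin n) ℂ →ₐ[ℂ] ℂ) hJac
    rw [AlgHom.map_det] at this
    rw [aeval_C, Algebra.algebraMap_self_apply] at this
    rw [← this]
    congr 1
    ext i j
    simp only [hF, AlgHom.mapMatrix_apply, Matrix.map_apply, Matrix.of_apply, Matrix.add_apply,
      map_add, Matrix.one_apply, pderiv_X, Pi.single_apply]
    by_cases h : i = j <;> simp [h, eq_comm]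
  have hlap : ∑ j, pderiv j (pderiv j P) = 0 := by
    apply MvPolynomial.funext
    intro a
    let M : Matrix (Fin n) (Fin n) ℂ := Matrix.of fun i j => aeval a (pderiv j (pderiv i P))
    have h1 : (1 + (Polynomial.X : Polynomial ℂ) • M.map Polynomial.C).det = Polynomial.C c := by
      apply Polynomial.funext
      intro s
      obtain ⟨t, rfl⟩ : ∃ t, s = t ^ 2 := by
        obtain ⟨t, ht⟩ := IsAlgClosed.exists_pow_nat_eq s (n := 2) (by norm_num)
        exact ⟨t, ht.symm⟩
      rw [Polynomial.eval_C, ← hJ (fun j => t * a j), ← Polynomial.coe_evalRingHom,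
        RingHom.map_det]
      congr 1
      ext i j
      simp only [Matrix.add_apply, Matrix.of_apply, yag_scale (hHH i j)]
      by_cases h : i = j <;> simp [M, h, Matrix.one_apply] <;> ring
    have h2 := Matrix.derivative_det_one_add_X_smul M
    rw [h1] at h2
    simp [Matrix.trace, M, aeval_eq_eval] at h2
    simpa using h2.symm
  intro i
  have hlap' : ∑ j, pderiv j (pderiv j (pderiv i P)) = 0 := by
    have := congrArg (pderiv i) hlap
    rw [map_sum, map_zero] at this
    rw [← this]
    refine Finset.sum_congr rfl fun j _ => ?_
    rw [yag_comm i j, yag_comm i j]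
  have hHi := hH i
  have hHHi := hHH i
  have hdet : ∀ a : Fin n → ℂ, (∀ j, (if i = j then 1 else 0) + aeval a (pderiv j (pderiv i P)) = 0) →
      False := by
    intro a h
    apply hc
    rw [← hJ a]
    apply Matrix.det_eq_zero_of_row_eq_zero i
    intro j
    rw [← h j]
    simp [Matrix.one_apply]
  rw [hF]
  generalize pderiv i P = H at *
  clear hJ hlap hH hHH hJac
  by_cases hX : X i ∣ H
  · obtain ⟨q, rfl⟩ := hX
    have hq : ∀ a : Fin n → ℂ, a i = 0 → aeval a q = 0 := by
      intro a ha
      by_contra hqa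
      obtain ⟨t, ht⟩ := IsAlgClosed.exists_pow_nat_eq (-(aeval a q)⁻¹) (n := 2) (by norm_num)
      apply hdet (fun j => t * a j)
      intro j
      rw [yag_scale (hHHi j), ht, pderiv_mul]
      by_cases h : i = j
      · subst h; simp only [aeval_eq_eval] at hqa ⊢; simp [ha, hqa]
      · simp [h, ha, pderiv_X_of_ne h]
    obtain ⟨l, rfl⟩ := yag_dvd i q hq
    obtain ⟨m, rfl⟩ := yag_harm i 0 l (by rw [← hlap']; refine Finset.sum_congr rfl fun j _ => congrArg _ (congrArg _ ?_); ring)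
    obtain ⟨r, rfl⟩ := yag_harm i 1 m (by rw [← hlap']; refine Finset.sum_congr rfl fun j _ => congrArg _ (congrArg _ ?_); ring)
    have hr : X i * (X i * (X i * (X i * r))) = 0 := by
      by_contra h0
      have h1 := totalDegree_le_of_dvd_of_isDomain (f := X i ^ 4) ⟨r, by ring⟩ h0
      have h2 := hHi.totalDegree_le
      rw [totalDegree_X_pow] at h1
      omega
    rw [hr, add_zero]
    exact X_prime.irreducible
  · have : ∃ a : Fin n → ℂ, a i = 0 ∧ aeval a H ≠ 0 := by
      by_contra! h
      exact hX (yag_dvd i H h)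
    obtain ⟨a, ha, hHa⟩ := this
    have hz : ∀ {d : ℕ} {G : MvPolynomial (Fin n) ℂ}, G.IsHomogeneous (d + 1) →
        aeval (0 : Fin n → ℂ) G = 0 := by
      intro d G hG
      have := yag_scale hG (0 : ℂ) (0 : Fin n → ℂ)
      simpa [← Pi.zero_def] using this
    constructor
    · intro hu
      have := hu.map (aeval (0 : Fin n → ℂ))
      rw [map_add, hz hHi] at this
      simp at this
    · intro A B hAB
      have hd := congrArg (fun G => aeval (0 : Fin n → ℂ) (pderiv i G)) hAB
      simp only [map_add, pderiv_mul, pderiv_X_self, map_one, map_mul, hz (hHHi i)] at hd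
      by_cases hA : aeval (0 : Fin n → ℂ) A = 0
      · right
        refine yag_unit i H B A hHi a ha hHa (by rw [hAB, mul_comm]) ?_
        intro hB
        simp [hA, hB] at hd
      · left
        exact yag_unit i H A B hHi a ha hHa hAB hA
end

section
/- Let n ≥ 1 and let H_1,…,H_n ∈ ℂ[x_1,…,x_n] be homogeneous polynomials of degree 3, and define F_i = x_i + H_i for i = 1,…,n (a map in Yagzhev's form). Assume that the Jacobian matrix of F is symmetric, i.e., ∂F_i/∂x_j = ∂F_j/∂x_i for all i,j, and that the Jacobian determinant of F is a nonzero constant polynomial. Then each polynomial F_i = x_i + H_i is irreducible in ℂ[x_1,…,x_n]. -/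
open MvPolynomial

lemma yg_eval_smul {n m : ℕ} {Q : MvPolynomial (Fin n) ℂ} (hQ : Q.IsHomogeneous m)
    (t : ℂ) (v : Fin n → ℂ) : eval (t • v) Q = t ^ m * eval v Q := by
  rw [eval_eq', eval_eq', Finset.mul_sum]
  refine Finset.sum_congr rfl fun d hd => ?_
  have h : d.degree = m := hQ.degree_eq_sum_deg_support hd |>.symm
  rw [Finsupp.degree_eq_sum] at h
  simp only [Pi.smul_apply, smul_eq_mul, mul_pow, Finset.prod_mul_distrib]
  rw [Finset.prod_pow_eq_pow_sum, h]
  ring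

lemma yg_pderiv_comm {n : ℕ} (i j : Fin n) (P : MvPolynomial (Fin n) ℂ) :
    pderiv i (pderiv j P) = pderiv j (pderiv i P) := by
  ext m
  simp only [coeff_pderiv]
  by_cases h : i = j
  · subst h; rfl
  · rw [add_right_comm]
    simp [Finsupp.single_apply, h, Ne.symm h]
    ring

lemma yg_trace {n : ℕ} (M : Matrix (Fin n) (Fin n) ℂ) (c : ℂ)
    (h : ∀ r : ℂ, (1 + r • M).det = c) : M.trace = 0 := by
  have h1 := Matrix.coeff_det_one_add_X_smul_one M
  have h2 : (1 + (Polynomial.X : Polynomial ℂ) • M.map Polynomial.C).det = Polynomial.C c := by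
    refine Polynomial.funext fun r => ?_
    rw [Polynomial.eval_C, ← h r, ← Polynomial.coe_evalRingHom, RingHom.map_det]
    congr 1
    ext a b
    by_cases hab : a = b
    · subst hab; simp; ring
    · simp [hab]; ring
  rw [h2] at h1
  simpa [Polynomial.coeff_C] using h1.symm

/-- Vanishing on the hyperplane means divisible by the variable. -/
lemma yg_X_dvd {n : ℕ} (i : Fin n) (Q : MvPolynomial (Fin n) ℂ)
    (h : ∀ v : Fin n → ℂ, v i = 0 → eval v Q = 0) : X i ∣ Q := by
  have key : ∀ P : MvPolynomial (Fin n) ℂ,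
      X i ∣ P - aeval (fun j => if j = i then 0 else X j) P := by
    intro P
    induction P using MvPolynomial.induction_on with
    | C a => simp [algebraMap_eq]
    | add p q hp hq =>
      have := dvd_add hp hq
      rw [map_add]
      convert this using 1
      ring
    | mul_X p j hp =>
      rw [map_mul, aeval_X]
      by_cases hj : j = i
      · simp [hj]
      · simp only [hj, if_false]
        rw [← sub_mul]
        exact Dvd.dvd.mul_right hp _
  have h0 : aeval (fun j => if j = i then (0 : MvPolynomial (Fin n) ℂ) else X j) Q = 0 := by
    refine MvPolynomial.funext fun v => ?_
    have := h (fun j => if j = i then 0 else v j) (by simp)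
    rw [map_zero, ← this, ← coe_aeval_eq_eval, ← coe_aeval_eq_eval]
    simp only [RingHom.coe_coe]
    rw [← AlgHom.comp_apply, comp_aeval]
    congr 2
    ext j
    split_ifs <;> simp
  have := key Q
  rwa [h0, sub_zero] at this

lemma yg_harmonic_step {n : ℕ} (i : Fin n) (P : MvPolynomial (Fin n) ℂ)
    (h : ∑ j, pderiv j (pderiv j P) = 0) (k : ℕ) (hk : X i ^ (k + 2) ∣ P) :
    X i ^ (k + 3) ∣ P := by
  obtain ⟨M, rfl⟩ := hk
  rw [pow_succ _ (k+2)]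
  refine mul_dvd_mul_left _ ?_
  rw [← Finset.add_sum_erase _ _ (Finset.mem_univ i)] at h
  have h2 : ∑ j ∈ Finset.univ.erase i, pderiv j (pderiv j (X i ^ (k+2) * M))
      = X i ^ (k+2) * ∑ j ∈ Finset.univ.erase i, pderiv j (pderiv j M) := by
    rw [Finset.mul_sum]
    refine Finset.sum_congr rfl fun j hj => ?_
    have hne : i ≠ j := fun h => by simp [h] at hj
    simp [pderiv_mul, pderiv_pow, pderiv_X_of_ne hne]
  rw [h2] at h
  simp only [pderiv_mul, pderiv_pow, pderiv_X_self, map_add] at h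
  have hX : (X i : MvPolynomial (Fin n) ℂ) ^ k ≠ 0 := pow_ne_zero _ (X_ne_zero i)
  have h3 : ((k+2)*(k+1) : MvPolynomial (Fin n) ℂ) * M = X i * (-(2 * ((k : MvPolynomial (Fin n) ℂ)+2) * pderiv i M
      + X i * pderiv i (pderiv i M)
      + X i * ∑ j ∈ Finset.univ.erase i, pderiv j (pderiv j M))) := by
    apply mul_left_cancel₀ hX
    have e1 : k + 2 - 1 = k + 1 := rfl
    simp only [e1, pderiv_X_self, pderiv_pow, Derivation.map_natCast, Nat.add_sub_cancel, pderiv_one] at h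
    push_cast at h
    linear_combination h
  have h4 : ((k+2)*(k+1) : MvPolynomial (Fin n) ℂ) = C (((k:ℂ)+2)*(k+1)) := by
    have : (C (2:ℂ) : MvPolynomial (Fin n) ℂ) = 2 := map_ofNat C 2
    simp [this]
  have h5 : (((k:ℂ)+2)*(k+1)) ≠ 0 := by
    have : (((k+2)*(k+1) : ℕ) : ℂ) ≠ 0 := by
      rw [Nat.cast_ne_zero]; positivity
    simpa using this
  rw [h4] at h3
  have h6 : M = C (((k:ℂ)+2)*(k+1))⁻¹ * (C (((k:ℂ)+2)*(k+1)) * M) := by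
    rw [← mul_assoc, ← C_mul, inv_mul_cancel₀ h5]; simp
  rw [h6, h3]
  exact Dvd.dvd.mul_left (dvd_mul_right _ _) _

lemma yg_harmonic {n : ℕ} (i : Fin n) (P : MvPolynomial (Fin n) ℂ)
    (h : ∑ j, pderiv j (pderiv j P) = 0) (hk : X i ^ 2 ∣ P) : P = 0 := by
  have all : ∀ k, X i ^ (k + 2) ∣ P := by
    intro k
    induction k with
    | zero => exact hk
    | succ k ih => exact yg_harmonic_step i P h k ih
  by_contra hP
  obtain ⟨M, hM⟩ := all P.totalDegree
  have hM0 : M ≠ 0 := by rintro rfl; exact hP (by simpa using hM)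
  have := congrArg totalDegree hM
  rw [totalDegree_mul_of_isDomain (pow_ne_zero _ (X_ne_zero i)) hM0, totalDegree_X_pow] at this
  omega

lemma yg_factor {n : ℕ} (i : Fin n) (H A B : MvPolynomial (Fin n) ℂ) (hH : H.IsHomogeneous 3)
    (hA : A.totalDegree ≤ 2) (hB : B.totalDegree ≤ 2) (h : X i + H = A * B)
    (hB0 : coeff 0 B = 0) : ∃ Q, Q.IsHomogeneous 2 ∧ H = X i * Q := by
  have dec : ∀ P : MvPolynomial (Fin n) ℂ, P.totalDegree ≤ 2 →
      P = homogeneousComponent 0 P + homogeneousComponent 1 P + homogeneousComponent 2 P := by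
    intro P hP
    have h1 := sum_homogeneousComponent P
    conv_lhs => rw [← h1]
    rw [Finset.sum_subset (s₂ := Finset.range 3)]
    · simp [Finset.sum_range_succ]
    · intro x hx; simp at hx ⊢; omega
    · intro x _ hx; exact homogeneousComponent_eq_zero _ _ (by simp at hx; omega)
  have hAd := dec A hA
  have hBd := dec B hB
  have ha1 := homogeneousComponent_isHomogeneous 1 A
  have ha2 := homogeneousComponent_isHomogeneous 2 A
  have hb1 := homogeneousComponent_isHomogeneous 1 B
  have hb2 := homogeneousComponent_isHomogeneous 2 B
  rw [homogeneousComponent_zero] at hAd hBd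
  rw [hB0, C_0, zero_add] at hBd
  generalize homogeneousComponent 1 A = a1 at *
  generalize homogeneousComponent 2 A = a2 at *
  generalize homogeneousComponent 1 B = b1 at *
  generalize homogeneousComponent 2 B = b2 at *
  generalize coeff 0 A = a at *
  have hp : X i + H = C a * b1 + (C a * b2 + a1 * b1) + (a1 * b2 + a2 * b1) + a2 * b2 := by
    rw [h, hAd, hBd]; ring
  have hX := isHomogeneous_X ℂ i
  have p1 : (C a * b1).IsHomogeneous 1 := hb1.C_mul a
  have p2 : (C a * b2 + a1 * b1).IsHomogeneous 2 := (hb2.C_mul a).add (ha1.mul hb1)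
  have p3 : (a1 * b2 + a2 * b1).IsHomogeneous 3 := (ha1.mul hb2).add (ha2.mul hb1)
  have p4 : (a2 * b2).IsHomogeneous 4 := ha2.mul hb2
  have comp : ∀ k, (if k = 1 then X i else 0) + (if k = 3 then H else 0) =
      (if k = 1 then C a * b1 else 0) + (if k = 2 then C a * b2 + a1 * b1 else 0)
      + (if k = 3 then a1 * b2 + a2 * b1 else 0) + (if k = 4 then a2 * b2 else 0) := by
    intro k
    have := congrArg (homogeneousComponent k) hp
    rw [map_add, map_add, map_add, map_add, homogeneousComponent_of_mem hX,
      homogeneousComponent_of_mem hH, homogeneousComponent_of_mem p1,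
      homogeneousComponent_of_mem p2, homogeneousComponent_of_mem p3,
      homogeneousComponent_of_mem p4] at this
    exact this
  have c1 := comp 1
  have c2 := comp 2
  have c3 := comp 3
  simp at c1 c2 c3
  have ha : a ≠ 0 := by
    rintro rfl
    simp at c1
  have hinv : C a⁻¹ * C a = (1 : MvPolynomial (Fin n) ℂ) := by
    rw [← C_mul, inv_mul_cancel₀ ha, C_1]
  refine ⟨C a⁻¹ * (a2 - C a⁻¹ * (a1 * a1)), ?_, ?_⟩
  · exact (ha2.sub ((ha1.mul ha1).C_mul _)).C_mul _
  · rw [c3, c1]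
    linear_combination (C a⁻¹ * a1) * c2.symm + (-(a1*b2) - a2 * b1 + C a⁻¹*a1*a1*b1) * hinv

theorem yg_main
    (n : ℕ) (H : Fin n → MvPolynomial (Fin n) ℂ)
    (hH : ∀ i, (H i).IsHomogeneous 3)
    (F : Fin n → MvPolynomial (Fin n) ℂ)
    (hF : ∀ i, F i = X i + H i)
    (hsymm : ∀ i j, pderiv j (F i) = pderiv i (F j))
    (c : ℂ) (hc : c ≠ 0)
    (hJac : (Matrix.of fun i j => pderiv j (F i)).det = C c) (i : Fin n) :
    (∃ Q, Q.IsHomogeneous 2 ∧ H i = X i * Q) → H i = 0 := by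
  rintro ⟨Q, hQ, hHQ⟩
  have hev : ∀ v : Fin n → ℂ, (Matrix.of fun i j => eval v (pderiv j (F i))).det = c := by
    intro v
    have := congrArg (eval v) hJac
    rw [RingHom.map_det, eval_C] at this
    exact this
  -- harmonicity
  have htr : ∑ j, pderiv j (H j) = 0 := by
    refine MvPolynomial.funext fun v => ?_
    have := yg_trace (Matrix.of fun i j => eval v (pderiv j (H i))) c ?_
    · simpa [Matrix.trace] using this
    · intro r
      obtain ⟨t, ht⟩ := IsAlgClosed.exists_pow_nat_eq r (n := 2) (by norm_num)
      rw [← hev (t • v)]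
      congr 1
      ext a b
      simp only [Matrix.add_apply, Matrix.smul_apply, Matrix.of_apply, hF, map_add]
      rw [yg_eval_smul (hH a).pderiv, ← ht]
      by_cases hab : a = b
      · subst hab; simp
      · simp [hab, pderiv_X_of_ne hab]
  have hsH : ∀ i j, pderiv j (H i) = pderiv i (H j) := by
    intro a b
    have := hsymm a b
    rw [hF, hF, map_add, map_add] at this
    by_cases hab : a = b
    · rw [hab]
    · simpa [pderiv_X_of_ne hab, pderiv_X_of_ne (Ne.symm hab)] using this
  have hharm : ∑ j, pderiv j (pderiv j (H i)) = 0 := by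
    have := congrArg (pderiv i) htr
    rw [map_sum, map_zero] at this
    rw [← this]
    refine Finset.sum_congr rfl fun j _ => ?_
    rw [hsH i j, yg_pderiv_comm]
  refine yg_harmonic i _ hharm ?_
  rw [hHQ, pow_two]
  refine mul_dvd_mul_left _ (yg_X_dvd i Q fun v hv => ?_)
  by_contra hq
  obtain ⟨t, ht⟩ := IsAlgClosed.exists_pow_nat_eq (-(eval v Q)⁻¹) (n := 2) (by norm_num)
  have hq' : eval (t • v) Q = -1 := by
    rw [yg_eval_smul hQ, ht]; field_simp
  apply hc
  rw [← hev (t • v)]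
  apply Matrix.det_eq_zero_of_row_eq_zero i
  intro j
  have hFi : F i = X i * (1 + Q) := by rw [hF, hHQ]; ring
  simp [hFi, pderiv_mul, hq', hv]

/-- A Yagzhev-form map `F i = x i + H i` (with `H i` homogeneous of
degree 3) with symmetric Jacobian matrix and constant nonzero Jacobian
determinant has all coordinates irreducible. -/
theorem yagzhev_symmetric_irreducible
    (n : ℕ) (hn : 1 ≤ n) (H : Fin n → MvPolynomial (Fin n) ℂ)
    (hH : ∀ i, (H i).IsHomogeneous 3)
    (F : Fin n → MvPolynomial (Fin n) ℂ)
    (hF : ∀ i, F i = X i + H i)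
    (hsymm : ∀ i j, pderiv j (F i) = pderiv i (F j))
    (c : ℂ) (hc : c ≠ 0)
    (hJac : (Matrix.of fun i j => pderiv j (F i)).det = C c) :
    ∀ i, Irreducible (F i) := by
  intro i
  by_cases h0 : H i = 0
  · rw [hF, h0, add_zero]
    exact X_prime.irreducible
  have hno : ¬ ∃ Q, Q.IsHomogeneous 2 ∧ H i = X i * Q :=
    fun h => h0 (yg_main n H hH F hF hsymm c hc hJac i h)
  have hH00 : coeff 0 (H i) = 0 := (hH i).coeff_eq_zero (by simp)
  have hF0 : coeff 0 (F i) = 0 := by rw [hF, coeff_add, hH00]; simp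
  have hFne : F i ≠ 0 := by
    intro h
    apply hno
    refine ⟨0, isHomogeneous_zero _ _ _, ?_⟩
    exfalso
    have := congrArg (homogeneousComponent 3) h
    rw [hF, map_add, homogeneousComponent_of_mem (hH i),
      homogeneousComponent_of_mem (isHomogeneous_X ℂ i)] at this
    simp at this
    exact h0 this
  have hFd : (F i).totalDegree ≤ 3 := by
    rw [hF]
    refine (totalDegree_add _ _).trans (max_le ?_ (hH i).totalDegree_le)
    simp
  have hunit : ∀ P : MvPolynomial (Fin n) ℂ, P ≠ 0 → P.totalDegree = 0 → IsUnit P := by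
    intro P hP hd
    rw [totalDegree_eq_zero_iff_eq_C] at hd
    rw [hd]
    refine IsUnit.map C (isUnit_iff_ne_zero.mpr ?_)
    intro h
    exact hP (by rw [hd, h, C_0])
  refine ⟨?_, ?_⟩
  · intro hu
    have := hu.map (constantCoeff (σ := Fin n) (R := ℂ))
    rw [constantCoeff_eq, hF0] at this
    simp at this
  · intro A B hAB
    by_contra hcon
    push Not at hcon
    have hA0 : A ≠ 0 := by rintro rfl; exact hFne (by simpa using hAB)
    have hB0 : B ≠ 0 := by rintro rfl; exact hFne (by simpa using hAB)
    have hdeg := totalDegree_mul_of_isDomain hA0 hB0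
    rw [← hAB] at hdeg
    have hA1 : A.totalDegree ≠ 0 := fun h => hcon.1 (hunit A hA0 h)
    have hB1 : B.totalDegree ≠ 0 := fun h => hcon.2 (hunit B hB0 h)
    have hz : coeff 0 A * coeff 0 B = 0 := by
      have := congrArg constantCoeff hAB
      rw [map_mul] at this
      simp only [constantCoeff_eq] at this
      rw [← this, hF0]
    rcases mul_eq_zero.mp hz with h | h
    · exact hno (yg_factor i (H i) B A (hH i) (by omega) (by omega)
        (by rw [← hF, hAB, mul_comm]) h)
    · exact hno (yg_factor i (H i) A B (hH i) (by omega) (by omega)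
        (by rw [← hF, hAB]) h)
end

section
/- Let n ≥ 1, let k ∈ {1,…,n}, and let H_k ∈ ℂ[x_1,…,x_n] be a nonzero homogeneous polynomial of degree 3. Then the polynomial f_k = x_k + H_k is reducible in ℂ[x_1,…,x_n] if and only if x_k divides H_k. -/
open MvPolynomial

lemma yag_isUnit_iff {n : ℕ} {p : MvPolynomial (Fin n) ℂ} (hp : p ≠ 0) :
    IsUnit p ↔ p.totalDegree = 0 := by
  constructor
  · intro h
    obtain ⟨q, hq⟩ := h.exists_right_inv
    have hq0 : q ≠ 0 := by rintro rfl; simp at hq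
    have := totalDegree_mul_of_isDomain hp hq0
    rw [hq, totalDegree_one] at this
    omega
  · intro h
    rw [totalDegree_eq_zero_iff_eq_C] at h
    rw [h] at hp ⊢
    exact (IsUnit.mk0 _ (by intro h0; simp [h0] at hp)).map C

lemma yag_aux {n : ℕ} (k : Fin n) (H a b : MvPolynomial (Fin n) ℂ) (hH : H.IsHomogeneous 3)
    (ha : a.totalDegree = 1) (hb : b.totalDegree = 2) (h : X k + H = a * b) : X k ∣ H := by
  have ea := sum_homogeneousComponent a
  have eb := sum_homogeneousComponent b
  rw [ha] at ea
  rw [hb] at eb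
  simp only [Finset.sum_range_succ, Finset.sum_range_zero, zero_add] at ea eb
  have ha0 := homogeneousComponent_isHomogeneous 0 a
  have ha1 := homogeneousComponent_isHomogeneous 1 a
  have hb0 := homogeneousComponent_isHomogeneous 0 b
  have hb1 := homogeneousComponent_isHomogeneous 1 b
  have hb2 := homogeneousComponent_isHomogeneous 2 b
  have ca : homogeneousComponent 0 a = C (coeff 0 a) := homogeneousComponent_zero a
  generalize homogeneousComponent 0 a = a0 at *
  generalize homogeneousComponent 1 a = a1 at *
  generalize homogeneousComponent 0 b = b0 at *
  generalize homogeneousComponent 1 b = b1 at *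
  generalize homogeneousComponent 2 b = b2 at *
  have key : ∀ m, homogeneousComponent m (X k + H) = homogeneousComponent m (a0*b0) +
      homogeneousComponent m (a0*b1) + homogeneousComponent m (a1*b0) +
      homogeneousComponent m (a0*b2) + homogeneousComponent m (a1*b1) +
      homogeneousComponent m (a1*b2) := by
    intro m
    rw [h, ← ea, ← eb, ← map_add, ← map_add, ← map_add, ← map_add, ← map_add]
    congr 1
    ring
  have hX : (X k : MvPolynomial (Fin n) ℂ).IsHomogeneous 1 := isHomogeneous_X _ k
  have key2 : ∀ m, (if m = 1 then X k else 0) + (if m = 3 then H else 0) =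
      (if m = 0 + 0 then a0*b0 else 0) + (if m = 0 + 1 then a0*b1 else 0) +
      (if m = 1 + 0 then a1*b0 else 0) + (if m = 0 + 2 then a0*b2 else 0) +
      (if m = 1 + 1 then a1*b1 else 0) + (if m = 1 + 2 then a1*b2 else 0) := by
    intro m
    have := key m
    rw [map_add, homogeneousComponent_of_mem hX, homogeneousComponent_of_mem hH,
      homogeneousComponent_of_mem (ha0.mul hb0), homogeneousComponent_of_mem (ha0.mul hb1),
      homogeneousComponent_of_mem (ha1.mul hb0), homogeneousComponent_of_mem (ha0.mul hb2),
      homogeneousComponent_of_mem (ha1.mul hb1), homogeneousComponent_of_mem (ha1.mul hb2)] at this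
    exact this
  have k0 := key2 0
  have k1 := key2 1
  have k2 := key2 2
  have k3 := key2 3
  norm_num at k0 k1 k2 k3
  by_cases h0 : a0 = 0
  · subst h0
    have hXp : X k = a1 * b0 := by simpa using k1
    have hb0' : b0 ≠ 0 := by
      rintro rfl
      exact X_ne_zero (R := ℂ) k (by simpa using hXp)
    have hu : IsUnit b0 := (yag_isUnit_iff hb0').2 (hb0.totalDegree hb0')
    rw [k3, hXp]
    exact (hu.mul_right_dvd.2 dvd_rfl).mul_right _
  · have hb : b0 = 0 := by tauto
    have hu : IsUnit a0 := (yag_isUnit_iff h0).2 (ha0.totalDegree h0)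
    have e : H * (a0 * a0) = X k * (- (a1 * a1)) := by
      rw [k3, k1, hb]
      linear_combination -a0 * a1 * k2
    exact (hu.mul hu).dvd_mul_right.1 ⟨_, e⟩

theorem yagzhev_coord_reducible_iff
    (n : ℕ) (hn : 1 ≤ n) (k : Fin n)
    (H : MvPolynomial (Fin n) ℂ) (hH0 : H ≠ 0) (hH : H.IsHomogeneous 3) :
    (X k + H ≠ 0 ∧ ¬ IsUnit (X k + H) ∧ ¬ Irreducible (X k + H)) ↔
      X k ∣ H := by
  have hd : (X k + H).totalDegree = 3 := by
    rw [totalDegree_add_eq_right_of_totalDegree_lt, hH.totalDegree hH0]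
    rw [hH.totalDegree hH0, totalDegree_X]
    norm_num
  have hne : X k + H ≠ 0 := by
    intro h
    simp [h] at hd
  have hnu : ¬ IsUnit (X k + H) := by
    rw [yag_isUnit_iff hne, hd]
    norm_num
  constructor
  · rintro ⟨-, -, hirr⟩
    rw [irreducible_iff] at hirr
    push Not at hirr
    obtain ⟨a, b, hab, hau, hbu⟩ := hirr hnu
    have ha0 : a ≠ 0 := by rintro rfl; simp [hab] at hne
    have hb0 : b ≠ 0 := by rintro rfl; simp [hab] at hne
    rw [yag_isUnit_iff ha0] at hau
    rw [yag_isUnit_iff hb0] at hbu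
    have hs := totalDegree_mul_of_isDomain ha0 hb0
    rw [← hab, hd] at hs
    rcases (by omega : (a.totalDegree = 1 ∧ b.totalDegree = 2) ∨
      (b.totalDegree = 1 ∧ a.totalDegree = 2)) with ⟨h1, h2⟩ | ⟨h1, h2⟩
    · exact yag_aux k H a b hH h1 h2 hab
    · exact yag_aux k H b a hH h1 h2 (by rw [hab, mul_comm])
  · rintro ⟨q, rfl⟩
    refine ⟨hne, hnu, fun hirr => ?_⟩
    have e : X k + X k * q = X k * (1 + q) := by ring
    have hq0 : 1 + q ≠ 0 := by
      intro h
      rw [e, h, mul_zero] at hne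
      exact hne rfl
    have hs := totalDegree_mul_of_isDomain (X_ne_zero (R := ℂ) k) hq0
    rw [← e, hd, totalDegree_X] at hs
    rcases hirr.isUnit_or_isUnit e with h | h
    · rw [yag_isUnit_iff (X_ne_zero k), totalDegree_X] at h
      omega
    · rw [yag_isUnit_iff hq0] at h
      omega
end

section
/- Let n ≥ 1, let k ∈ {1,…,n}, and let H_k ∈ ℂ[x_1,…,x_n] be a nonzero homogeneous polynomial of degree 3. If the polynomial f_k = x_k + H_k is reducible in ℂ[x_1,…,x_n], then x_k divides H_k. -/
open MvPolynomial

lemma yag_unit_s3 {n : ℕ} (a : MvPolynomial (Fin n) ℂ) (ha : a ≠ 0) (h : a.totalDegree = 0) :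
    IsUnit a := by
  rw [totalDegree_eq_zero_iff_eq_C] at h
  rw [h]
  apply IsUnit.map
  rw [isUnit_iff_ne_zero]
  intro h0
  rw [h0, C_0] at h
  exact ha h

lemma yag_key {n : ℕ} (k : Fin n) (H a b : MvPolynomial (Fin n) ℂ) (hH : H.IsHomogeneous 3)
    (hab : X k + H = a * b) (ha : a.totalDegree = 1) (hb : b.totalDegree = 2) : X k ∣ H := by
  have ea := sum_homogeneousComponent a
  have eb := sum_homogeneousComponent b
  rw [ha] at ea
  rw [hb] at eb
  simp only [Finset.sum_range_succ, Finset.range_zero, Finset.sum_empty, zero_add,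
    homogeneousComponent_zero] at ea eb
  have ha1 := homogeneousComponent_isHomogeneous 1 a
  have hb1 := homogeneousComponent_isHomogeneous 1 b
  have hb2 := homogeneousComponent_isHomogeneous 2 b
  generalize homogeneousComponent 1 a = a1 at *
  generalize homogeneousComponent 1 b = b1 at *
  generalize homogeneousComponent 2 b = b2 at *
  generalize coeff 0 a = a0 at *
  generalize coeff 0 b = b0 at *
  have hX : (X k : MvPolynomial (Fin n) ℂ).IsHomogeneous 1 := isHomogeneous_X _ _
  have h0 : (C (a0 * b0) : MvPolynomial (Fin n) ℂ).IsHomogeneous 0 := isHomogeneous_C _ _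
  have h1 : (C a0 * b1 + C b0 * a1).IsHomogeneous 1 := (hb1.C_mul _).add (ha1.C_mul _)
  have h2 : (C a0 * b2 + a1 * b1).IsHomogeneous 2 := (hb2.C_mul _).add (ha1.mul hb1)
  have h3 : (a1 * b2).IsHomogeneous 3 := ha1.mul hb2
  have e : X k + H = C (a0 * b0) + (C a0 * b1 + C b0 * a1) + (C a0 * b2 + a1 * b1) + a1 * b2 := by
    rw [hab, ← ea, ← eb, C_mul]; ring
  have ee := fun i => congrArg (homogeneousComponent i) e
  simp only [map_add (homogeneousComponent _) (X k) H,
    map_add (homogeneousComponent _) _ (a1 * b2),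
    map_add (homogeneousComponent _) _ (C a0 * b2 + a1 * b1),
    map_add (homogeneousComponent _) _ (C a0 * b1 + C b0 * a1),
    homogeneousComponent_of_mem hX, homogeneousComponent_of_mem hH,
    homogeneousComponent_of_mem h0, homogeneousComponent_of_mem h1,
    homogeneousComponent_of_mem h2, homogeneousComponent_of_mem h3] at ee
  have e0 := ee 0
  have e1 := ee 1
  have e2 := ee 2
  have e3 := ee 3
  norm_num at e0 e1 e2 e3
  rw [e3]
  have hu : ∀ c : ℂ, c ≠ 0 → IsUnit (C c : MvPolynomial (Fin n) ℂ) := fun c hc =>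
    (isUnit_iff_ne_zero.mpr hc).map C
  have hXne : (X k : MvPolynomial (Fin n) ℂ) ≠ 0 := X_ne_zero k
  by_cases haz : a0 = 0
  · subst haz
    have hbz : b0 ≠ 0 := by
      rintro rfl
      simp at e1
    simp at e1
    exact Dvd.dvd.mul_right ((hu b0 hbz).dvd_mul_left.mp (dvd_of_eq e1)) _
  · have hbz : b0 = 0 := by tauto
    subst hbz
    simp at e1
    have hx : X k ∣ b1 := (hu a0 haz).dvd_mul_left.mp (dvd_of_eq e1)
    have : C a0 * b2 = - a1 * b1 := by linear_combination -e2
    have h : X k ∣ C a0 * b2 := by rw [this]; exact hx.mul_left _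
    exact ((hu a0 haz).dvd_mul_left.mp h).mul_left _

/-- For a nonzero homogeneous `H` of degree 3, if `x k + H` is
reducible (nonzero, not a unit, not irreducible), then `x k ∣ H`. -/
theorem yagzhev_coord_reducible_dvd
    (n : ℕ) (hn : 1 ≤ n) (k : Fin n)
    (H : MvPolynomial (Fin n) ℂ) (hH0 : H ≠ 0) (hH : H.IsHomogeneous 3)
    (hred : X k + H ≠ 0 ∧ ¬ IsUnit (X k + H) ∧ ¬ Irreducible (X k + H)) :
    X k ∣ H := by
  obtain ⟨hne, hnu, hni⟩ := hred
  rw [irreducible_iff] at hni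
  push Not at hni
  obtain ⟨a, b, hab, hau, hbu⟩ := hni hnu
  have ha : a ≠ 0 := by rintro rfl; simp at hab; exact hne hab
  have hb : b ≠ 0 := by rintro rfl; simp at hab; exact hne hab
  have hd : a.totalDegree + b.totalDegree = 3 := by
    rw [← totalDegree_mul_of_isDomain ha hb, ← hab, add_comm,
      totalDegree_add_eq_left_of_totalDegree_lt]
    · exact hH.totalDegree hH0
    · rw [hH.totalDegree hH0, totalDegree_X]; norm_num
  have h1 : a.totalDegree ≠ 0 := fun h => hau (yag_unit_s3 a ha h)
  have h2 : b.totalDegree ≠ 0 := fun h => hbu (yag_unit_s3 b hb h)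
  have : (a.totalDegree = 1 ∧ b.totalDegree = 2) ∨ (b.totalDegree = 1 ∧ a.totalDegree = 2) := by
    omega
  rcases this with ⟨h, h'⟩ | ⟨h, h'⟩
  · exact yag_key k H a b hH hab h h'
  · exact yag_key k H b a hH (by rw [hab, mul_comm]) h h'
end

section
/- Let n ≥ 1 and let P ∈ ℂ[x_1,…,x_n] be a homogeneous polynomial of degree 4. Define F_i = x_i + ∂P/∂x_i for i = 1,…,n. If the Jacobian determinant of F = (F_1,…,F_n) is a nonzero constant polynomial, then the trace of the Hessian matrix of P vanishes, i.e., ∑_{i=1}^n ∂²P/∂x_i² = 0. -/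
open MvPolynomial

lemma hom_scale {n k : ℕ} (p : MvPolynomial (Fin n) ℂ) (hp : p.IsHomogeneous k) :
    eval₂Hom ((Polynomial.C : MvPolynomial (Fin n) ℂ →+* _).comp C)
      (fun i => Polynomial.C (X i) * Polynomial.X) p = Polynomial.C p * Polynomial.X ^ k := by
  conv_rhs => rw [p.as_sum]
  rw [coe_eval₂Hom, eval₂_eq', map_sum, Finset.sum_mul]
  refine Finset.sum_congr rfl fun d hd => ?_
  have h : ∑ i, d i = k := by
    have := hp (mem_support_iff.mp hd)
    rw [← this, Finsupp.weight_apply, Finsupp.sum_fintype] <;> simp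
  rw [monomial_eq, Finsupp.prod_fintype _ _ (by simp)]
  simp only [mul_pow, Finset.prod_mul_distrib, Finset.prod_pow_eq_pow_sum, h, map_mul, map_prod,
    map_pow, RingHom.comp_apply, mul_assoc]


/-- If `P` is homogeneous of degree 4 and `F i = x i + ∂P/∂x i` has
constant nonzero Jacobian determinant, then the trace of the Hessian of `P`
vanishes: `∑ i, ∂²P/∂x i² = 0`. -/
theorem hessian_trace_eq_zero
    (n : ℕ) (hn : 1 ≤ n) (P : MvPolynomial (Fin n) ℂ)
    (hP : P.IsHomogeneous 4)
    (F : Fin n → MvPolynomial (Fin n) ℂ)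
    (hF : ∀ i, F i = X i + pderiv i P)
    (c : ℂ) (hc : c ≠ 0)
    (hJac : (Matrix.of fun i j => pderiv j (F i)).det = C c) :
    ∑ i, pderiv i (pderiv i P) = 0 := by
  classical
  set H : Matrix (Fin n) (Fin n) (MvPolynomial (Fin n) ℂ) :=
    Matrix.of fun i j => pderiv j (pderiv i P) with hH
  have hhom : ∀ i j, (H i j).IsHomogeneous 2 := fun i j => by
    simpa [hH] using (hP.pderiv (i := i)).pderiv (i := j)
  have hM : (Matrix.of fun i j => pderiv j (F i)) = 1 + H := by
    ext1 i j
    simp [hF, hH, pderiv_X, Matrix.one_apply, Pi.single_apply, eq_comm]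
  rw [hM] at hJac
  have h1 := congrArg (eval₂Hom ((Polynomial.C : MvPolynomial (Fin n) ℂ →+* _).comp C)
      (fun i => Polynomial.C (X i) * Polynomial.X)) hJac
  rw [RingHom.map_det] at h1
  set q := Matrix.det (1 + (Polynomial.X : Polynomial (MvPolynomial (Fin n) ℂ)) •
    H.map Polynomial.C) with hq
  have h2 : Polynomial.expand _ 2 q = Polynomial.C (C c) := by
    rw [hq, AlgHom.map_det]
    refine Eq.trans ?_ (h1.trans ?_)
    · congr 1
      rw [map_add, map_add, map_one, map_one]
      congr 1
      ext1 i j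
      simp only [AlgHom.mapMatrix_apply, RingHom.mapMatrix_apply, Matrix.map_apply,
        Matrix.smul_apply, hom_scale _ (hhom i j), smul_eq_mul, map_mul, Polynomial.expand_X,
        Polynomial.expand_C]
      ring
    · simp
  have h3 := congrArg (fun r => Polynomial.coeff r (1 * 2)) h2
  simp only [Polynomial.coeff_expand_mul (show 0 < 2 by norm_num), hq,
    Matrix.coeff_det_one_add_X_smul_one] at h3
  simpa [Matrix.trace, hH, Polynomial.coeff_C] using h3
end
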